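/- For every real b > 0, the steady-state scaled photon number of the laser equation satisfies the exact formula (∫₀^∞ n·exp((n − n²/2)/b²) dn) / (∫₀^∞ exp((n − n²/2)/b²) dn) = 1 + √(2/π)·b / (exp(1/(2b²))·(1 + erf(1/(√2·b)))), where erf is the Gauss error function erf(z) = (2/√π)·∫₀^z e^{−t²} dt. (Both integrals are finite and the denominator is positive.) -/

import Mathlib

open MeasureTheory

/-- The Gauss error function `erf z = (2/√π)·∫₀^z e^{−t²} dt`. -/
noncomputable def erf (z : ℝ) : ℝ :=
  (2 / Real.sqrt Real.pi) * ∫ t in (0 : ℝ)..z, Real.exp (-t ^ 2)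

theorem integral_comp_sub_right_Ioi (f : ℝ → ℝ) (a d : ℝ) :
    ∫ x in Set.Ioi a, f (x - d) = ∫ x in Set.Ioi (a - d), f x := by
  have h := (measurePreserving_sub_right volume d).setIntegral_preimage_emb
    (Homeomorph.subRight d).measurableEmbedding f (Set.Ioi (a - d))
  rwa [Set.preimage_sub_const_Ioi, sub_add_cancel] at h

theorem erf_nonneg {z : ℝ} (hz : 0 ≤ z) : 0 ≤ erf z :=
  mul_nonneg (by positivity)
    (intervalIntegral.integral_nonneg hz fun _ _ => (Real.exp_pos _).le)

theorem integral_Ioi_neg_exp_neg_sq (k : ℝ) :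
    ∫ t in Set.Ioi (-k), Real.exp (-t ^ 2) = √Real.pi / 2 * (1 + erf k) := by
  have hint : Integrable fun t : ℝ => Real.exp (-t ^ 2) := by
    simpa using integrable_exp_neg_mul_sq one_pos
  have hhalf : ∫ t in Set.Ioi (0 : ℝ), Real.exp (-t ^ 2) = √Real.pi / 2 := by
    simpa using integral_gaussian_Ioi 1
  have hsymm : ∫ t in (-k)..0, Real.exp (-t ^ 2) = ∫ t in (0 : ℝ)..k, Real.exp (-t ^ 2) := by
    have h := intervalIntegral.integral_comp_neg (a := -k) (b := 0)
      fun t : ℝ => Real.exp (-t ^ 2)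
    simpa only [neg_sq, neg_zero, neg_neg] using h
  rw [← intervalIntegral.integral_interval_add_Ioi (b := 0) hint.integrableOn hint.integrableOn,
    hhalf, hsymm, erf]
  have hpi : √Real.pi ≠ 0 := by positivity
  field_simp
  ring

theorem integral_Ioi_exp_neg_mul_sub_one_sq {k : ℝ} (hk : 0 < k) :
    ∫ x in Set.Ioi (0 : ℝ), Real.exp (-(k * (x - 1)) ^ 2)
      = k⁻¹ * (√Real.pi / 2 * (1 + erf k)) := by
  rw [integral_comp_sub_right_Ioi (fun y => Real.exp (-(k * y) ^ 2)),
    integral_comp_mul_left_Ioi (fun y => Real.exp (-y ^ 2)) _ hk,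
    show k * (0 - 1) = -k by ring, integral_Ioi_neg_exp_neg_sq, smul_eq_mul]

theorem photon_weight_eq {b : ℝ} (hb : b ≠ 0) (x : ℝ) :
    Real.exp ((x - x ^ 2 / 2) / b ^ 2)
      = Real.exp (1 / (2 * b ^ 2)) * Real.exp (-(1 / (2 * b ^ 2)) * (x - 1) ^ 2) := by
  rw [← Real.exp_add]
  congr 1
  field_simp
  ring

theorem integrable_photon_weight {b : ℝ} (hb : 0 < b) :
    Integrable fun x : ℝ => Real.exp ((x - x ^ 2 / 2) / b ^ 2) := by
  simp_rw [photon_weight_eq hb.ne']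
  exact ((integrable_exp_neg_mul_sq (by positivity)).comp_sub_right 1).const_mul _

theorem integrable_sub_one_mul_photon_weight {b : ℝ} (hb : 0 < b) :
    Integrable fun x : ℝ => (x - 1) * Real.exp ((x - x ^ 2 / 2) / b ^ 2) := by
  simp_rw [photon_weight_eq hb.ne', mul_left_comm _ (Real.exp (1 / (2 * b ^ 2)))]
  exact ((integrable_mul_exp_neg_mul_sq (by positivity)).comp_sub_right 1).const_mul _

theorem integral_photon_weight {b : ℝ} (hb : 0 < b) :
    ∫ x in Set.Ioi (0 : ℝ), Real.exp ((x - x ^ 2 / 2) / b ^ 2)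
      = Real.exp (1 / (2 * b ^ 2)) *
        (√2 * b * (√Real.pi / 2 * (1 + erf (1 / (√2 * b))))) := by
  have hk : 0 < 1 / (√2 * b) := by positivity
  have hsq (x : ℝ) : -(1 / (2 * b ^ 2)) * (x - 1) ^ 2 = -(1 / (√2 * b) * (x - 1)) ^ 2 := by
    rw [mul_pow, div_pow, mul_pow, Real.sq_sqrt zero_le_two]
    ring
  simp_rw [photon_weight_eq hb.ne', hsq]
  rw [integral_const_mul, integral_Ioi_exp_neg_mul_sub_one_sq hk, one_div (√2 * b), inv_inv]

theorem integral_sub_one_mul_photon_weight {b : ℝ} (hb : 0 < b) :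
    ∫ x in Set.Ioi (0 : ℝ), (x - 1) * Real.exp ((x - x ^ 2 / 2) / b ^ 2) = b ^ 2 := by
  have hderiv (x : ℝ) : HasDerivAt (fun y : ℝ => -b ^ 2 * Real.exp ((y - y ^ 2 / 2) / b ^ 2))
      ((x - 1) * Real.exp ((x - x ^ 2 / 2) / b ^ 2)) x := by
    convert! ((((hasDerivAt_id x).sub (((hasDerivAt_id x).pow 2).div_const 2)).div_const
      (b ^ 2)).exp.const_mul (-b ^ 2)) using 1
    simp
    field_simp
    ring
  have hint := (integrable_sub_one_mul_photon_weight hb).integrableOn (s := Set.Ioi 0)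
  have hlim := tendsto_zero_of_hasDerivAt_of_integrableOn_Ioi (fun x _ => hderiv x) hint
    ((integrable_photon_weight hb).const_mul _).integrableOn
  rw [integral_Ioi_of_hasDerivAt_of_tendsto' (fun x _ => hderiv x) hint hlim]
  simp

/-- For every `b > 0`, the steady-state scaled photon number of
the laser equation satisfies the exact formula
`(∫₀^∞ n·e^{(n−n²/2)/b²} dn)/(∫₀^∞ e^{(n−n²/2)/b²} dn)
  = 1 + √(2/π)·b/(e^{1/(2b²)}·(1 + erf(1/(√2·b))))`,
both integrals being finite and the denominator positive. -/
theorem stmt_16 (b : ℝ) (hb : 0 < b) :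
    IntegrableOn (fun n : ℝ => Real.exp ((n - n ^ 2 / 2) / b ^ 2)) (Set.Ioi 0) ∧
    IntegrableOn (fun n : ℝ => n * Real.exp ((n - n ^ 2 / 2) / b ^ 2)) (Set.Ioi 0) ∧
    0 < ∫ n in Set.Ioi (0 : ℝ), Real.exp ((n - n ^ 2 / 2) / b ^ 2) ∧
    (∫ n in Set.Ioi (0 : ℝ), n * Real.exp ((n - n ^ 2 / 2) / b ^ 2))
        / (∫ n in Set.Ioi (0 : ℝ), Real.exp ((n - n ^ 2 / 2) / b ^ 2))
      = 1 + Real.sqrt (2 / Real.pi) * b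
          / (Real.exp (1 / (2 * b ^ 2)) * (1 + erf (1 / (Real.sqrt 2 * b)))) := by
  have hf := (integrable_photon_weight hb).integrableOn (s := Set.Ioi 0)
  have hg := (integrable_sub_one_mul_photon_weight hb).integrableOn (s := Set.Ioi 0)
  have hsplit : (fun n : ℝ => n * Real.exp ((n - n ^ 2 / 2) / b ^ 2)) = fun n =>
      (n - 1) * Real.exp ((n - n ^ 2 / 2) / b ^ 2) + Real.exp ((n - n ^ 2 / 2) / b ^ 2) := by
    ext n
    ring
  have herf : 0 < 1 + erf (1 / (√2 * b)) :=
    add_pos_of_pos_of_nonneg one_pos (erf_nonneg (by positivity))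
  rw [hsplit, integral_add hg hf, integral_sub_one_mul_photon_weight hb,
    integral_photon_weight hb]
  refine ⟨hf, hg.add hf, by positivity, ?_⟩
  rw [Real.sqrt_div zero_le_two]
  have hpi : √Real.pi ≠ 0 := by positivity
  have htwo : √(2 : ℝ) ^ 2 = 2 := Real.sq_sqrt zero_le_two
  generalize erf (1 / (√2 * b)) = e at *
  generalize hw : Real.exp (1 / (2 * b ^ 2)) = w
  have : 0 < w := hw ▸ Real.exp_pos _
  field_simp
  linear_combination -b * htwo
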